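/- Let A and B be non-empty subsets of [n] with |A| + |B| ≤ n, and set A′ = A ∖ A^t and B′ = B ∖ B^t. Then the pair (A,B) is maximal if and only if A′ is the partner of B′. -/

import Mathlib

open Finset

attribute [local instance] Classical.propDecidable

noncomputable section

/-- The ground set `[n] = {1, …, n}`. -/
def ground (n : ℕ) : Finset ℕ := Finset.Icc 1 n

/-- `C([n], k)`: the family of all `k`-element subsets of `[n]`. -/
def ksubsets (n k : ℕ) : Finset (Finset ℕ) := Finset.powersetCard k (ground n)

/-- Two families are cross intersecting. -/
def CrossInt (A B : Finset (Finset ℕ)) : Prop :=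
  ∀ a ∈ A, ∀ b ∈ B, (a ∩ b).Nonempty

/-- The lexicographic order `A ≺ B`:  `A ⊇ B` or `min (A ∖ B) < min (B ∖ A)`. -/
def lex (A B : Finset ℕ) : Prop :=
  B ⊆ A ∨ (A \ B).min < (B \ A).min

/-- Strict lexicographic order `A ⪵ B`. -/
def lexLT (A B : Finset ℕ) : Prop := lex A B ∧ A ≠ B

/-- `L(R, k)` over `[n]`: all `k`-subsets of `[n]` that are `≺ R`. -/
def Lset (n : ℕ) (R : Finset ℕ) (k : ℕ) : Finset (Finset ℕ) :=
  (ksubsets n k).filter fun F => lex F R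

/-- `L(r, k)`: the first `r` elements of `C([n], k)` in lexicographic order. -/
def Lnum (n r k : ℕ) : Finset (Finset ℕ) :=
  (ksubsets n k).filter fun F => ((ksubsets n k).filter fun G => lex G F).card ≤ r

/-- A family is L-initial if it equals `L(R, k)` for some `k`-set `R` (an ID of the family). -/
def LInitial (n k : ℕ) (A : Finset (Finset ℕ)) : Prop :=
  ∃ R ∈ ksubsets n k, A = Lset n R k

/-- `F` and `H` strongly intersect at their last element; `H` is the partner of `F`
(and `F` is the partner of `H`). -/
def IsPartner (F H : Finset ℕ) : Prop :=
  ∃ q, F ∩ H = {q} ∧ F ∪ H = Finset.Icc 1 q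

/-- `K` is the `k`-partner of `F` (inside `[n]`). -/
def IsKPartner (n k : ℕ) (F K : Finset ℕ) : Prop :=
  ∃ H, IsPartner F H ∧
    ((k = H.card ∧ K = H) ∨
     (H.card < k ∧ K = H ∪ Finset.Icc (n - k + H.card + 1) n) ∨
     (k < H.card ∧ K ∈ ksubsets n k ∧ lex K H ∧
        ∀ K' ∈ ksubsets n k, lex K' H → lex K' K))

/-- `ℓ(F)`: the largest `x` with `{n - x + 1, …, n} ⊆ F` (and `0` if there is none). -/
def ell (n : ℕ) (F : Finset ℕ) : ℕ :=
  ((Finset.range (n + 1)).filter fun x => Finset.Icc (n - x + 1) n ⊆ F).sup id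

/-- `F^t = {n - ℓ(F) + 1, …, n}` (which is `∅` when `ℓ(F) = 0`). -/
def tailPart (n : ℕ) (F : Finset ℕ) : Finset ℕ := Finset.Icc (n - ell n F + 1) n

/-- Maximal cross intersecting families. -/
def MaximalCross (n f g : ℕ) (F G : Finset (Finset ℕ)) : Prop :=
  F ⊆ ksubsets n f ∧ G ⊆ ksubsets n g ∧ CrossInt F G ∧
    ∀ F' G' : Finset (Finset ℕ), F ⊆ F' → F' ⊆ ksubsets n f →
      G ⊆ G' → G' ⊆ ksubsets n g → CrossInt F' G' → F = F' ∧ G = G'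

/-- The pair of sets `(F, G)` is maximal. -/
def PairMaximal (n : ℕ) (F G : Finset ℕ) : Prop :=
  MaximalCross n F.card G.card (Lset n F F.card) (Lset n G G.card)

/-- Maximal pair families. -/
def MaximalPairFamilies (n : ℕ) (A1 A2 : Finset (Finset ℕ)) : Prop :=
  A1.card = A2.card ∧ ∀ a1 ∈ A1, ∃! a2, a2 ∈ A2 ∧ PairMaximal n a1 a2

/-- `H1` is the `|H1|`-parity of `H2` (intended for `|H1| ≤ |H2|`):
`H1 ∖ H1^t = H2 ∖ H2^t` and `ℓ(H2) - ℓ(H1) = |H2| - |H1|`. -/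
def IsParity (n : ℕ) (H1 H2 : Finset ℕ) : Prop :=
  H1 \ tailPart n H1 = H2 \ tailPart n H2 ∧
    ell n H2 + H1.card = ell n H1 + H2.card

/-- The family `H1` of `h1`-sets is the `h1`-parity of the family `H2` of `h2`-sets. -/
def FamParity (n h1 h2 : ℕ) (H1 H2 : Finset (Finset ℕ)) : Prop :=
  (∀ A ∈ H1, ∃ B ∈ ksubsets n h2, IsParity n A B ∧ B ∈ H2) ∧
  (∀ B ∈ H2, ∀ A ∈ ksubsets n h1, IsParity n A B → A ∈ H1)

/-- An `(n, k 0, …, k (t-1))`-cross intersecting system:  non-empty pairwise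
cross intersecting families `F i ⊆ C([n], k i)`. -/
def IsCIS (n : ℕ) {t : ℕ} (k : Fin t → ℕ) (F : Fin t → Finset (Finset ℕ)) : Prop :=
  (∀ i, F i ⊆ ksubsets n (k i)) ∧ (∀ i, (F i).Nonempty) ∧
    ∀ i j : Fin t, i < j → CrossInt (F i) (F j)

/-- An extremal cross intersecting system. -/
def Extremal (n : ℕ) {t : ℕ} (k : Fin t → ℕ) (F : Fin t → Finset (Finset ℕ)) : Prop :=
  IsCIS n k F ∧ ∀ G : Fin t → Finset (Finset ℕ), IsCIS n k G →
    ∑ i, (G i).card ≤ ∑ i, (F i).card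

/-- Two systems of families are isomorphic via a permutation of the ground set `[n]`. -/
def IsoSystems (n : ℕ) {t : ℕ} (F G : Fin t → Finset (Finset ℕ)) : Prop :=
  ∃ σ : Equiv.Perm ℕ, (∀ x ∈ ground n, σ x ∈ ground n) ∧
    ∀ i, F i = (G i).image fun s => s.image ⇑σ

/-- The family `ℛ₂`. -/
def R2fam (n k2 kt : ℕ) : Finset (Finset ℕ) :=
  (ksubsets n k2).filter fun R =>
    lex (insert 1 (Finset.Icc (n - k2 + 2) n)) R ∧
    lex R (insert kt (Finset.Icc (n - k2 + 2) n))

/-- The family `ℱ₂,₃`. -/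
def F23 (n k2 k3 kt : ℕ) : Finset (Finset ℕ) :=
  (R2fam n k2 kt).filter fun A => ∃ B ∈ ksubsets n k3, PairMaximal n A B

theorem lex_iff {A B : Finset ℕ} :
    lex A B ↔ B ⊆ A ∨ ∃ x ∈ A, x ∉ B ∧ ∀ y ∈ B, y ∉ A → x < y := by
  unfold lex
  refine or_congr_right' fun hBA => ⟨fun h => ?_, ?_⟩
  · obtain ⟨x, hx⟩ := WithTop.ne_top_iff_exists.1 (ne_top_of_lt h)
    have hxm := Finset.mem_of_min hx.symm
    rw [mem_sdiff] at hxm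
    refine ⟨x, hxm.1, hxm.2, fun y hyB hyA => ?_⟩
    rw [← hx] at h
    exact WithTop.coe_lt_coe.1 (h.trans_le (Finset.min_le (mem_sdiff.2 ⟨hyB, hyA⟩)))
  · rintro ⟨x, hxA, hxB, h⟩
    obtain ⟨y, hyB, hyA⟩ := not_subset.1 hBA
    obtain ⟨m, hm⟩ := Finset.min_of_mem (mem_sdiff.2 ⟨hyB, hyA⟩)
    have hmm := mem_sdiff.1 (Finset.mem_of_min hm)
    rw [hm]
    exact (Finset.min_le (mem_sdiff.2 ⟨hxA, hxB⟩)).trans_lt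
      (WithTop.coe_lt_coe.2 (h m hmm.1 hmm.2))

theorem lex_of_subset {A B : Finset ℕ} (h : B ⊆ A) : lex A B := Or.inl h

theorem lex_mono_right {F P A : Finset ℕ} (hPA : P ⊆ A) (h : lex F A) : lex F P := by
  rw [lex_iff] at h ⊢
  rcases h with h | ⟨x, hxF, hxA, h⟩
  · exact Or.inl (hPA.trans h)
  · exact Or.inr ⟨x, hxF, fun hx => hxA (hPA hx), fun y hy hyF => h y (hPA hy) hyF⟩

theorem mem_tailPart {n p : ℕ} {A : Finset ℕ} :
    p ∈ tailPart n A ↔ (1 ≤ p ∧ p ≤ n) ∧ Finset.Icc p n ⊆ A := by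
  have hmem : ell n A ∈ (Finset.range (n + 1)).filter fun x => Finset.Icc (n - x + 1) n ⊆ A := by
    obtain ⟨x, hx, hxe⟩ := Finset.exists_mem_eq_sup
      ((Finset.range (n + 1)).filter fun x => Finset.Icc (n - x + 1) n ⊆ A)
      ⟨0, by simp⟩ id
    rw [ell, hxe]
    exact hx
  rw [mem_filter, mem_range] at hmem
  rw [tailPart, mem_Icc]
  constructor
  · rintro ⟨h1, h2⟩
    exact ⟨by omega, (Finset.Icc_subset_Icc_left h1).trans hmem.2⟩
  · rintro ⟨⟨h1, h2⟩, h⟩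
    have : n - p + 1 ≤ ell n A := by
      refine Finset.le_sup (f := id) (mem_filter.2 ⟨mem_range.2 (by omega), ?_⟩)
      convert h using 2
      omega
    omega

theorem zero_notMem_of_subset_ground {n : ℕ} {A : Finset ℕ} (hA : A ⊆ ground n) : 0 ∉ A :=
  fun h => absurd (mem_Icc.1 (hA h)).1 (by simp)

theorem exists_gt_notMem {n p : ℕ} {A : Finset ℕ} (hA : A ⊆ ground n)
    (hp : p ∈ A \ tailPart n A) : ∃ y, p < y ∧ y ≤ n ∧ y ∉ A := by
  rw [mem_sdiff, mem_tailPart] at hp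
  have hpn := mem_Icc.1 (hA hp.1)
  obtain ⟨y, hy, hyA⟩ := not_subset.1 fun h => hp.2 ⟨hpn, h⟩
  rw [mem_Icc] at hy
  refine ⟨y, lt_of_le_of_ne hy.1 ?_, hy.2, hyA⟩
  rintro rfl
  exact hyA hp.1

theorem lex_iff_lex_sdiff_tailPart {n : ℕ} {F A : Finset ℕ} (hF : F ⊆ ground n)
    (hcard : F.card = A.card) : lex F A ↔ lex F (A \ tailPart n A) := by
  refine ⟨lex_mono_right sdiff_subset, fun h => ?_⟩
  rw [lex_iff] at h ⊢
  by_cases hFA : F ⊆ A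
  · exact Or.inl (eq_of_subset_of_card_le hFA hcard.ge).ge
  right
  rcases h with h | ⟨x, hxF, hxA, h⟩
  · obtain ⟨x, hxF, hxA⟩ := not_subset.1 hFA
    refine ⟨x, hxF, hxA, fun y hyA hyF => ?_⟩
    have hyt : y ∈ tailPart n A := by
      by_contra hyt
      exact hyF (h (mem_sdiff.2 ⟨hyA, hyt⟩))
    by_contra! hxy
    exact hxA ((mem_tailPart.1 hyt).2 (mem_Icc.2 ⟨hxy, (mem_Icc.1 (hF hxF)).2⟩))
  · by_cases hxt : x ∈ A
    · have hxt' : x ∈ tailPart n A := by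
        by_contra hx
        exact hxA (mem_sdiff.2 ⟨hxt, hx⟩)
      obtain ⟨z, hzF, hzA⟩ := not_subset.1 hFA
      have key : ∀ t ∈ tailPart n A, z < t := by
        intro t ht
        by_contra! htz
        exact hzA ((mem_tailPart.1 ht).2 (mem_Icc.2 ⟨htz, (mem_Icc.1 (hF hzF)).2⟩))
      refine ⟨z, hzF, hzA, fun y hyA hyF => ?_⟩
      by_cases hyt : y ∈ tailPart n A
      · exact key y hyt
      · exact (key x hxt').trans (h y (mem_sdiff.2 ⟨hyA, hyt⟩) hyF)
    · refine ⟨x, hxF, hxt, fun y hyA hyF => ?_⟩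
      by_cases hyt : y ∈ tailPart n A
      · by_contra! hxy
        exact hxt ((mem_tailPart.1 hyt).2 (mem_Icc.2 ⟨hxy, (mem_Icc.1 (hF hxF)).2⟩))
      · exact h y (mem_sdiff.2 ⟨hyA, hyt⟩) hyF

theorem mem_Lset_iff {n : ℕ} {F A : Finset ℕ} :
    F ∈ Lset n A A.card ↔ F ∈ ksubsets n A.card ∧ lex F (A \ tailPart n A) := by
  rw [Lset, mem_filter]
  refine and_congr_right fun hF => ?_
  rw [ksubsets, mem_powersetCard] at hF
  exact lex_iff_lex_sdiff_tailPart hF.1 hF.2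

theorem IsPartner.symm {P Q : Finset ℕ} (h : IsPartner P Q) : IsPartner Q P := by
  obtain ⟨q, h1, h2⟩ := h
  exact ⟨q, by rw [inter_comm, h1], by rw [union_comm, h2]⟩

theorem IsPartner.inter_nonempty {P Q F G : Finset ℕ} (h : IsPartner P Q) (hF0 : 0 ∉ F)
    (hG0 : 0 ∉ G) (hF : lex F P) (hG : lex G Q) : (F ∩ G).Nonempty := by
  obtain ⟨q, hi, hu⟩ := h
  have hq : q ∈ P ∩ Q := by simp [hi]
  rw [mem_inter] at hq
  have hP : ∀ x ∈ P, 1 ≤ x ∧ x ≤ q := fun x hx =>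
    mem_Icc.1 (hu ▸ mem_union_left Q hx)
  have hQ : ∀ x ∈ Q, 1 ≤ x ∧ x ≤ q := fun x hx =>
    mem_Icc.1 (hu ▸ mem_union_right P hx)
  have hPQ : ∀ x, 1 ≤ x → x ≤ q → x ∈ P ∨ x ∈ Q := fun x h1 h2 =>
    mem_union.1 (hu ▸ mem_Icc.2 ⟨h1, h2⟩)
  have hpos : ∀ {S : Finset ℕ}, 0 ∉ S → ∀ x ∈ S, 1 ≤ x := fun h x hx =>
    Nat.one_le_iff_ne_zero.2 fun h0 => h (h0 ▸ hx)
  by_contra hFG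
  have hFG : ∀ x ∈ F, x ∉ G := fun x hxF hxG => hFG ⟨x, mem_inter.2 ⟨hxF, hxG⟩⟩
  rw [lex_iff] at hF hG
  rcases hF with hF | ⟨x, hxF, hxP, hx⟩ <;> rcases hG with hG | ⟨y, hyG, hyQ, hy⟩
  · exact hFG q (hF hq.1) (hG hq.2)
  · have hqG := hFG q (hF hq.1)
    have hyq := hy q hq.2 hqG
    exact hFG y (hF ((hPQ y (hpos hG0 y hyG) hyq.le).resolve_right hyQ)) hyG
  · have hqF : q ∉ F := fun h => hFG q h (hG hq.2)
    have hxq := hx q hq.1 hqF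
    exact hFG x hxF (hG ((hPQ x (hpos hF0 x hxF) hxq.le).resolve_left hxP))
  · have hx1 := hpos hF0 x hxF
    have hy1 := hpos hG0 y hyG
    grind

/-- A set failing to precede `P` misses some member of any uniform family preceding the partner
of `P`, provided the ground set is large enough. -/
theorem IsPartner.exists_disjoint {n b : ℕ} {P Q F : Finset ℕ} (h : IsPartner P Q)
    (hQn : Q ⊆ ground n) (hQb : Q.card ≤ b) (hF : F ⊆ ground n) (hFb : F.card + b ≤ n)
    (hFP : ¬ lex F P) : ∃ G ∈ ksubsets n b, lex G Q ∧ ¬ (F ∩ G).Nonempty := by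
  obtain ⟨q, hi, hu⟩ := h
  have hq : q ∈ P ∩ Q := by simp [hi]
  rw [mem_inter] at hq
  have hP : ∀ x ∈ P, 1 ≤ x ∧ x ≤ q := fun x hx =>
    mem_Icc.1 (hu ▸ mem_union_left Q hx)
  have hQ : ∀ x ∈ Q, 1 ≤ x ∧ x ≤ q := fun x hx =>
    mem_Icc.1 (hu ▸ mem_union_right P hx)
  have hPQ : ∀ x, 1 ≤ x → x ≤ q → x ∈ P ∨ x ∈ Q := fun x h1 h2 =>
    mem_union.1 (hu ▸ mem_Icc.2 ⟨h1, h2⟩)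
  have hPQq : ∀ x ∈ P, x ∈ Q → x = q := fun x h1 h2 =>
    mem_singleton.1 (hi ▸ mem_inter.2 ⟨h1, h2⟩)
  rw [lex_iff, not_or] at hFP
  obtain ⟨hPF, hFP⟩ := hFP
  push Not at hFP
  obtain ⟨x, hx, hxmin⟩ := (P \ F).exists_min_image id (sdiff_nonempty.2 hPF)
  simp only [id, mem_sdiff] at hx hxmin
  have hxF : ∀ w ∈ F, w ∉ P → x < w := fun w hw hwP => by
    obtain ⟨y, hyP, hyF, hyw⟩ := hFP w hw hwP
    exact lt_of_le_of_ne ((hxmin y ⟨hyP, hyF⟩).trans hyw) fun h => hwP (h ▸ hx.1)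
  have hxq := (hP x hx.1).2
  have hqn := (mem_Icc.1 (hQn hq.2)).2
  have hS : insert x (Q.filter (· < x)) ⊆ ground n \ F := by
    intro w hw
    rw [mem_sdiff]
    rcases mem_insert.1 hw with rfl | hw
    · exact ⟨mem_Icc.2 ⟨(hP w hx.1).1, hxq.trans hqn⟩, hx.2⟩
    · rw [mem_filter] at hw
      refine ⟨hQn hw.1, fun hwF => ?_⟩
      by_cases hwP : w ∈ P
      · have := hPQq w hwP hw.1
        omega
      · have := hxF w hwF hwP
        omega
  have hScard : (insert x (Q.filter (· < x))).card ≤ b := by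
    refine (card_le_card (t := insert x (Q.erase q)) (insert_subset_insert _ ?_)).trans ?_
    · intro w hw
      rw [mem_filter] at hw
      exact mem_erase.2 ⟨by omega, hw.1⟩
    · refine (card_insert_le _ _).trans ?_
      rwa [card_erase_add_one hq.2]
  have hg : (ground n).card = n := by simp [ground]
  obtain ⟨G, hSG, hG, hGb⟩ := exists_subsuperset_card_eq hS hScard
    (by rw [card_sdiff_of_subset hF, hg]; omega)
  rw [subset_sdiff] at hG
  have hsmall : ∀ y ∈ Q, y < x → y ∈ G := fun y hy hyx =>
    hSG (mem_insert_of_mem (mem_filter.2 ⟨hy, hyx⟩))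
  have hxG : x ∈ G := hSG (mem_insert_self _ _)
  refine ⟨G, mem_powersetCard.2 ⟨hG.1, hGb⟩, ?_, ?_⟩
  · rw [lex_iff]
    by_cases hxQ : x ∈ Q
    · left
      intro y hy
      obtain rfl := hPQq x hx.1 hxQ
      rcases (hQ y hy).2.lt_or_eq with h | rfl
      · exact hsmall y hy h
      · exact hxG
    · refine Or.inr ⟨x, hxG, hxQ, fun y hy hyG => ?_⟩
      by_contra! hyx
      rcases hyx.lt_or_eq with h | rfl
      · exact hyG (hsmall y hy h)
      · exact hxQ hy
  · rw [not_nonempty_iff_eq_empty, ← disjoint_iff_inter_eq_empty]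
    exact hG.2.symm

theorem exists_disjoint_ksubsets {n a b : ℕ} {S T : Finset ℕ} (hS : S ⊆ ground n)
    (hT : T ⊆ ground n) (hST : Disjoint S T) (hSa : S.card ≤ a) (hTb : T.card ≤ b)
    (hab : a + b ≤ n) :
    ∃ F ∈ ksubsets n a, ∃ G ∈ ksubsets n b, S ⊆ F ∧ T ⊆ G ∧ ¬ (F ∩ G).Nonempty := by
  have hg : (ground n).card = n := by simp [ground]
  obtain ⟨F, hSF, hF, hFa⟩ := exists_subsuperset_card_eq (subset_sdiff.2 ⟨hS, hST⟩) hSa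
    (by rw [card_sdiff_of_subset hT, hg]; omega)
  rw [subset_sdiff] at hF
  obtain ⟨G, hTG, hG, hGb⟩ := exists_subsuperset_card_eq (subset_sdiff.2 ⟨hT, hF.2.symm⟩) hTb
    (by rw [card_sdiff_of_subset hF.1, hg]; omega)
  rw [subset_sdiff] at hG
  refine ⟨F, mem_powersetCard.2 ⟨hF.1, hFa⟩, G, mem_powersetCard.2 ⟨hG.1, hGb⟩, hSF, hTG, ?_⟩
  rw [not_nonempty_iff_eq_empty, ← disjoint_iff_inter_eq_empty]
  exact hG.2.symm

theorem maximalCross_iff {n f g : ℕ} {F G : Finset (Finset ℕ)} (hF : F ⊆ ksubsets n f)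
    (hG : G ⊆ ksubsets n g) :
    MaximalCross n f g F G ↔ CrossInt F G ∧
      (∀ S ∈ ksubsets n f, (∀ T ∈ G, (S ∩ T).Nonempty) → S ∈ F) ∧
      (∀ T ∈ ksubsets n g, (∀ S ∈ F, (S ∩ T).Nonempty) → T ∈ G) := by
  constructor
  · rintro ⟨-, -, hc, hm⟩
    refine ⟨hc, fun S hS hST => ?_, fun T hT hST => ?_⟩
    · have := (hm (insert S F) G (subset_insert _ _) (insert_subset hS hF) Subset.rfl hG ?_).1
      · rw [this]; exact mem_insert_self _ _
      · intro a ha b hb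
        rcases mem_insert.1 ha with rfl | ha
        · exact hST b hb
        · exact hc a ha b hb
    · have := (hm F (insert T G) Subset.rfl hF (subset_insert _ _) (insert_subset hT hG) ?_).2
      · rw [this]; exact mem_insert_self _ _
      · intro a ha b hb
        rcases mem_insert.1 hb with rfl | hb
        · exact hST a ha
        · exact hc a ha b hb
  · rintro ⟨hc, h1, h2⟩
    refine ⟨hF, hG, hc, fun F' G' hFF hF' hGG hG' hc' => ⟨?_, ?_⟩⟩
    · exact hFF.antisymm fun S hS => h1 S (hF' hS) fun T hT => hc' S hS T (hGG hT)
    · exact hGG.antisymm fun T hT => h2 T (hG' hT) fun S hS => hc' S (hFF hS) T hT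

/-- If every set meeting all sets preceding `Q` precedes `A ∖ A^t`, then a partner of `Q` that is
an initial segment of `A ∖ A^t` is all of `A ∖ A^t`. -/
theorem le_of_mem_sdiff_tailPart {n z : ℕ} {A Q : Finset ℕ} (hA : A ⊆ ground n)
    (hPQ : IsPartner ((A \ tailPart n A).filter (· ≤ z)) Q)
    (hmax : ∀ S ∈ ksubsets n A.card, (∀ T, 0 ∉ T → lex T Q → (S ∩ T).Nonempty) →
      lex S (A \ tailPart n A)) : ∀ x ∈ A \ tailPart n A, x ≤ z := by
  by_contra! hx
  obtain ⟨x, hxA, hzx⟩ := hx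
  set A' := A \ tailPart n A with hA'
  obtain ⟨p, hp, hpmax⟩ := A'.exists_max_image id ⟨x, hxA⟩
  simp only [id] at hpmax
  have hzp : z < p := hzx.trans_le (hpmax x hxA)
  obtain ⟨y, hpy, hyn, hyA⟩ := exists_gt_notMem hA hp
  have hpA : p ∈ A := (mem_sdiff.1 hp).1
  have hpF : p ∉ insert y (A.erase p) := by simp [hpy.ne]
  have hlex := hmax (insert y (A.erase p)) (mem_powersetCard.2 ⟨?_, ?_⟩)
    fun T hT0 hT => hPQ.inter_nonempty ?_ hT0 (lex_of_subset ?_) hT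
  · rw [lex_iff] at hlex
    rcases hlex with h | ⟨w, hw, hwA, h⟩
    · exact hpF (h hp)
    · have hwp := h p hp hpF
      rcases mem_insert.1 hw with rfl | hw
      · omega
      · have hwA2 := (mem_erase.1 hw).2
        have hwt : w ∈ tailPart n A := by
          by_contra hwt
          exact hwA (mem_sdiff.2 ⟨hwA2, hwt⟩)
        exact hyA ((mem_tailPart.1 hwt).2 (mem_Icc.2 ⟨by omega, hyn⟩))
  · exact insert_subset (mem_Icc.2 ⟨by omega, hyn⟩) ((erase_subset _ _).trans hA)
  · rw [card_insert_of_notMem (by simp [hyA]), card_erase_add_one hpA]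
  · rw [mem_insert, not_or]
    exact ⟨by omega, fun h => zero_notMem_of_subset_ground hA (mem_erase.1 h).2⟩
  · intro w hw
    rw [mem_filter] at hw
    exact mem_insert_of_mem (mem_erase.2 ⟨by omega, (mem_sdiff.1 hw.1).1⟩)

/-- `(A,B)` is maximal iff `A ∖ A^t` is the partner of `B ∖ B^t`. -/
theorem pairMaximal_iff_partner (n : ℕ) (A B : Finset ℕ)
    (hA : A ⊆ ground n) (hB : B ⊆ ground n) (hAne : A.Nonempty) (hBne : B.Nonempty)
    (hcard : A.card + B.card ≤ n) :
    PairMaximal n A B ↔ IsPartner (B \ tailPart n B) (A \ tailPart n A) := by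
  have hLs : ∀ C : Finset ℕ, Lset n C C.card ⊆ ksubsets n C.card := fun C => filter_subset _ _
  have hk0 : ∀ {k : ℕ} {S : Finset ℕ}, S ∈ ksubsets n k → 0 ∉ S := fun h =>
    zero_notMem_of_subset_ground (mem_powersetCard.1 h).1
  rw [PairMaximal, maximalCross_iff (hLs A) (hLs B)]
  simp only [CrossInt, mem_Lset_iff]
  have hA' : A \ tailPart n A ⊆ ground n := sdiff_subset.trans hA
  have hB' : B \ tailPart n B ⊆ ground n := sdiff_subset.trans hB
  have hAc : (A \ tailPart n A).card ≤ A.card := card_le_card sdiff_subset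
  have hBc : (B \ tailPart n B).card ≤ B.card := card_le_card sdiff_subset
  have hAmax := fun z Q => le_of_mem_sdiff_tailPart (z := z) (Q := Q) hA
  have hBmax := fun z Q => le_of_mem_sdiff_tailPart (z := z) (Q := Q) hB
  generalize A \ tailPart n A = P at *
  generalize B \ tailPart n B = Q at *
  constructor
  · rintro ⟨hc, h1, h2⟩
    have hdisj : ∀ S ⊆ ground n, Disjoint S Q → S.card ≤ P.card → ¬ (∀ F, S ⊆ F → lex F P) := by
      intro S hS hSQ hSc hlex
      obtain ⟨F, hF, G, hG, hSF, hQG, hFG⟩ :=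
        exists_disjoint_ksubsets hS hB' hSQ (hSc.trans hAc) hBc hcard
      exact hFG (hc F ⟨hF, hlex F hSF⟩ G ⟨hG, lex_of_subset hQG⟩)
    obtain ⟨z, hz, hzmin⟩ : ∃ z ∈ P ∩ Q, ∀ x ∈ P ∩ Q, z ≤ x := by
      refine exists_min_image _ id (nonempty_iff_ne_empty.2 fun h => ?_)
      exact hdisj P hA' (disjoint_iff_inter_eq_empty.2 h) le_rfl fun F => lex_of_subset
    rw [mem_inter] at hz
    have hzn := mem_Icc.1 (hA' hz.1)
    have hcover : ∀ x, 1 ≤ x → x ≤ z → x ∈ P ∨ x ∈ Q := by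
      intro x hx1 hxz
      by_contra! hx
      have hxz' : x < z := lt_of_le_of_ne hxz fun h => hx.1 (h ▸ hz.1)
      refine hdisj (insert x (P.filter (· < x))) ?_ ?_ ?_ fun F hF => ?_
      · exact insert_subset (mem_Icc.2 ⟨hx1, by omega⟩) ((filter_subset _ _).trans hA')
      · rw [disjoint_insert_left]
        refine ⟨hx.2, disjoint_left.2 fun w hwP hwQ => ?_⟩
        rw [mem_filter] at hwP
        have := hzmin w (mem_inter.2 ⟨hwP.1, hwQ⟩)
        omega
      · refine (card_le_card (t := insert x (P.erase z)) (insert_subset_insert _ ?_)).trans ?_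
        · intro w hw
          rw [mem_filter] at hw
          exact mem_erase.2 ⟨by omega, hw.1⟩
        · refine (card_insert_le _ _).trans ?_
          rw [card_erase_add_one hz.1]
      · rw [lex_iff]
        refine Or.inr ⟨x, hF (mem_insert_self _ _), hx.1, fun y hyP hyF => ?_⟩
        by_contra! hyx
        refine hyF (hF (mem_insert_of_mem (mem_filter.2 ⟨hyP, lt_of_le_of_ne hyx ?_⟩)))
        rintro rfl
        exact hx.1 hyP
    have hpart : IsPartner (P.filter (· ≤ z)) (Q.filter (· ≤ z)) := by
      refine ⟨z, ?_, ?_⟩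
      · ext w
        simp only [mem_inter, mem_filter, mem_singleton]
        constructor
        · rintro ⟨⟨hwP, hwz⟩, hwQ, -⟩
          exact hwz.antisymm (hzmin w (mem_inter.2 ⟨hwP, hwQ⟩))
        · rintro rfl
          exact ⟨⟨hz.1, le_rfl⟩, hz.2, le_rfl⟩
      · ext w
        simp only [mem_union, mem_filter, mem_Icc]
        constructor
        · rintro (⟨hw, hwz⟩ | ⟨hw, hwz⟩)
          · exact ⟨(mem_Icc.1 (hA' hw)).1, hwz⟩
          · exact ⟨(mem_Icc.1 (hB' hw)).1, hwz⟩
        · rintro ⟨hw1, hwz⟩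
          exact (hcover w hw1 hwz).imp (fun h => ⟨h, hwz⟩) fun h => ⟨h, hwz⟩
    have hPz := hAmax z _ hpart fun S hS hT => (h1 S hS fun T hTm =>
      hT T (hk0 hTm.1) (lex_mono_right (filter_subset _ _) hTm.2)).2
    have hQz := hBmax z _ hpart.symm fun S hS hT => (h2 S hS fun T hTm => by
      rw [inter_comm]
      exact hT T (hk0 hTm.1) (lex_mono_right (filter_subset _ _) hTm.2)).2
    rw [filter_true_of_mem hPz, filter_true_of_mem hQz] at hpart
    exact hpart.symm
  · intro h
    refine ⟨fun F hF G hG => h.symm.inter_nonempty (hk0 hF.1) (hk0 hG.1) hF.2 hG.2,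
      fun F hF hFG => ⟨hF, ?_⟩, fun G hG hFG => ⟨hG, ?_⟩⟩
    · by_contra hlex
      have hF' := mem_powersetCard.1 hF
      obtain ⟨G, hG, hGQ, hd⟩ := h.symm.exists_disjoint hB' hBc hF'.1 (by omega) hlex
      exact hd (hFG G ⟨hG, hGQ⟩)
    · by_contra hlex
      have hG' := mem_powersetCard.1 hG
      obtain ⟨F, hF, hFP, hd⟩ := h.exists_disjoint hA' hAc hG'.1 (by omega) hlex
      rw [inter_comm] at hd
      exact hd (hFG F ⟨hF, hFP⟩)
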